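/- In every execution of Algorithm A_k in which both processes decide, if {r_1, r_2} = {k−1, k} then neither process decides via the normal-termination branch (the branch taken when r = k and the last value read from the other process's register equals k mod 2). -/

import Mathlib

/-!
Operational semantics of the two-process 1-bit-register approximate-agreement
protocol `A_k` (Algorithm 1 of the paper).

The two processes are indexed by `Fin 2`.  Shared memory consists of two 1-bit
registers `R 0, R 1` (initialized to `false`, i.e. `0`; only process `i` writes
`R i`) and two write-once input registers `I 0, I 1` (initialized to `⊥ = none`).
Each read or write of a single register is one atomic step.  An execution is
determined by the inputs `x : Fin 2 → Bool` together with a schedule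
`sched : ℕ → Fin 2` telling which process takes the next step (a step of a
process that has already decided is a no-op; a process crashes by being
scheduled only finitely often).
-/

namespace AlgoAk

/-- The other process. -/
def other (i : Fin 2) : Fin 2 := if i = 0 then 1 else 0

/-- The value (0 or 1) as a rational. -/
def bq (b : Bool) : ℚ := if b then 1 else 0

/-- Program counter of a process:
`start` = about to write its input to its input register;
`loopW` = about to perform the write of the current for-loop iteration;
`loopR` = about to perform the read of the current for-loop iteration;
`readMine` = left the for-loop, about to read its own input register;
`readOther` = about to read the other input register (and then decide);
`done` = has decided. -/
inductive PC where
  | start | loopW | loopR | readMine | readOther | done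
deriving DecidableEq

/-- Local state of a process: program counter, loop variable `r`, local
variables `prec` and `new`, the value read from the other input register,
and the output (once decided). -/
structure PState where
  pc : PC
  r : ℕ
  prec : Bool
  new : Bool
  xother : Option Bool
  out : Option ℚ

/-- Global configuration: local states, the two 1-bit registers, and the two
write-once input registers. -/
structure Config where
  p : Fin 2 → PState
  R : Fin 2 → Bool
  I : Fin 2 → Option Bool

/-- Initial local state. -/
def initP : PState := ⟨PC.start, 1, false, false, none, none⟩

/-- Initial configuration. -/
def initC : Config := ⟨fun _ => initP, fun _ => false, fun _ => none⟩

/-- Update the local state of process `i`. -/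
def updP (c : Config) (i : Fin 2) (s : PState) : Config :=
  { c with p := Function.update c.p i s }

/-- The decision function of the protocol, computed from the process' own input
`xme`, the value `xother` read from the other input register, and the values
`r` and `new` of the local variables when the for-loop was left. -/
def decideVal (k : ℕ) (xme : Bool) (xother : Option Bool) (r : ℕ) (new : Bool) : ℚ :=
  match xother with
  | none => bq xme
  | some xo =>
    if xme = xo then bq xme
    else if r = k ∧ new = decide (k % 2 = 1) then
      -- normal termination after k iterations
      let xwho := if r % 2 = 0 then xme else xo
      (bq xwho + (k : ℚ)) / (2 * (k : ℚ) + 1)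
    else
      -- left the loop via a break at iteration r
      let xwho := if r % 2 = 0 then xo else xme
      bq xwho + ((-1 : ℚ) ^ (if xwho then 1 else 0) * ((r : ℚ) - 1)) / (2 * (k : ℚ) + 1)

/-- One atomic step of process `i` in configuration `c`. -/
def step (k : ℕ) (x : Fin 2 → Bool) (c : Config) (i : Fin 2) : Config :=
  let s := c.p i
  match s.pc with
  | PC.start =>
      let c' := updP c i { s with pc := PC.loopW }
      { c' with I := Function.update c'.I i (some (x i)) }
  | PC.loopW =>
      let c' := updP c i { s with pc := PC.loopR }
      { c' with R := Function.update c'.R i (decide (s.r % 2 = 1)) }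
  | PC.loopR =>
      let nv := c.R (other i)
      if nv ≠ s.prec then
        if s.r < k then
          updP c i { s with pc := PC.loopW, r := s.r + 1, prec := nv, new := nv }
        else
          updP c i { s with pc := PC.readMine, prec := nv, new := nv }
      else
        updP c i { s with pc := PC.readMine, new := nv }
  | PC.readMine =>
      updP c i { s with pc := PC.readOther }
  | PC.readOther =>
      let xo := c.I (other i)
      updP c i { s with pc := PC.done, xother := xo,
                        out := some (decideVal k (x i) xo s.r s.new) }
  | PC.done => c

/-- The configuration after `n` steps of the execution of `A_k` with inputs `x`
and schedule `sched`. -/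
def run (k : ℕ) (x : Fin 2 → Bool) (sched : ℕ → Fin 2) : ℕ → Config
  | 0 => initC
  | n + 1 => step k x (run k x sched n) (sched n)

end AlgoAk

namespace AlgoAk

/-- The local state `s` of process with input `xme` is a final state reached via
the normal-termination branch of the decision code: the process has decided,
it saw a different input of the other process, and when it left its for-loop the
loop variable was `k` and the last value read from the other register was
`k mod 2`. -/
def decidedNormal (k : ℕ) (xme : Bool) (s : PState) : Prop :=
  s.pc = PC.done ∧ ∃ xo : Bool, s.xother = some xo ∧ xme ≠ xo ∧
    s.r = k ∧ s.new = decide (k % 2 = 1)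

end AlgoAk

namespace AlgoAk

theorem other_ne (i : Fin 2) : other i ≠ i := by
  fin_cases i <;> decide

theorem other_other (i : Fin 2) : other (other i) = i := by
  fin_cases i <;> decide

theorem eq_or_eq_other (i j : Fin 2) : i = j ∨ i = other j := by
  fin_cases i <;> fin_cases j <;> decide

/-- The number of writes to its 1-bit register performed by a process in local state `s`. -/
def PState.writes (s : PState) : ℕ :=
  if s.pc = PC.start ∨ s.pc = PC.loopW then s.r - 1 else s.r

/-- The process has not left its for-loop yet. -/
def PState.InLoop (s : PState) : Prop :=
  s.pc = PC.start ∨ s.pc = PC.loopW ∨ s.pc = PC.loopR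

/-- What holds for a process in local state `s` when its own register contains `b` and the
other process has performed `m` writes. -/
structure PState.Valid (s : PState) (b : Bool) (m : ℕ) : Prop where
  reg : b = decide (s.writes % 2 = 1)
  one_le : 1 ≤ s.r
  pred_le : s.r - 1 ≤ m
  prec_eq : s.InLoop → s.prec = decide ((s.r - 1) % 2 = 1)
  le_of_new : ¬ s.InLoop → s.new = decide (s.r % 2 = 1) → s.r ≤ m

/-- Every process is in a valid local state. -/
def Config.Valid (c : Config) : Prop :=
  ∀ i, (c.p i).Valid (c.R i) (c.p (other i)).writes

theorem PState.Valid.mono {s : PState} {b : Bool} {m m' : ℕ} (h : s.Valid b m) (hm : m ≤ m') :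
    s.Valid b m' :=
  ⟨h.reg, h.one_le, h.pred_le.trans hm, h.prec_eq, fun h₁ h₂ => (h.le_of_new h₁ h₂).trans hm⟩

theorem PState.writes_le_r (s : PState) : s.writes ≤ s.r := by
  unfold PState.writes
  split_ifs <;> omega

theorem step_p_of_ne (k : ℕ) (x : Fin 2 → Bool) (c : Config) {i j : Fin 2} (h : i ≠ j) :
    (step k x c j).p i = c.p i := by
  cases hpc : (c.p j).pc <;> simp only [step, updP, hpc] <;> (try split_ifs) <;> simp [h]

theorem step_R_of_ne (k : ℕ) (x : Fin 2 → Bool) (c : Config) {i j : Fin 2} (h : i ≠ j) :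
    (step k x c j).R i = c.R i := by
  cases hpc : (c.p j).pc <;> simp only [step, updP, hpc] <;> (try split_ifs) <;> simp [h]

theorem writes_le_writes_step (k : ℕ) (x : Fin 2 → Bool) (c : Config) (j : Fin 2) :
    (c.p j).writes ≤ ((step k x c j).p j).writes := by
  cases hpc : (c.p j).pc <;> simp only [step, updP, hpc] <;> (try split_ifs) <;>
    simp [PState.writes, hpc]

theorem Config.Valid.step {c : Config} (h : c.Valid) (k : ℕ) (x : Fin 2 → Bool) (j : Fin 2) :
    (step k x c j).Valid := by
  intro i
  rcases eq_or_eq_other i j with rfl | rfl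
  · rw [step_p_of_ne k x c (other_ne i)]
    obtain ⟨reg, one_le, pred_le, prec_eq, le_of_new⟩ := h i
    have reg_other := (h (other i)).reg
    generalize hm : (c.p (other i)).writes = m at *
    cases hpc : (c.p i).pc <;> simp only [AlgoAk.step, updP, hpc] <;> (try split_ifs) <;>
      simp only [PState.writes, PState.InLoop, hpc] at reg prec_eq le_of_new <;>
      constructor <;> (try simp only [PState.writes, PState.InLoop, Function.update_self]) <;>
      grind
  · rw [step_p_of_ne k x c (other_ne j), step_R_of_ne k x c (other_ne j), other_other]
    have hj := h (other j)
    rw [other_other] at hj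
    exact hj.mono (writes_le_writes_step k x c j)

theorem run_valid (k : ℕ) (x : Fin 2 → Bool) (sched : ℕ → Fin 2) (n : ℕ) :
    (run k x sched n).Valid := by
  induction n with
  | zero => exact fun i => ⟨rfl, le_rfl, Nat.zero_le _, fun _ => rfl, fun h => (h (Or.inl rfl)).elim⟩
  | succ n ih => exact ih.step k x (sched n)

theorem step_p_of_done (k : ℕ) (x : Fin 2 → Bool) (c : Config) (i j : Fin 2)
    (h : (c.p i).pc = PC.done) : (step k x c j).p i = c.p i := by
  by_cases hij : i = j
  · subst hij
    simp [step, h]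
  · exact step_p_of_ne k x c hij

theorem run_p_of_done {k : ℕ} {x : Fin 2 → Bool} {sched : ℕ → Fin 2} {n m : ℕ} {i : Fin 2}
    (h : ((run k x sched n).p i).pc = PC.done) (hnm : n ≤ m) :
    (run k x sched m).p i = (run k x sched n).p i := by
  induction m, hnm using Nat.le_induction with
  | base => rfl
  | succ m _ ih =>
    rw [run, step_p_of_done _ _ _ _ _ (by rw [ih, h]), ih]

/-- A process that decides normally does so only once the other one has written `k` times. -/
theorem le_writes_of_decidedNormal {k : ℕ} {b : Bool} {c : Config} {i : Fin 2} (hc : c.Valid)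
    (h : decidedNormal k b (c.p i)) : k ≤ (c.p (other i)).writes := by
  obtain ⟨hpc, -, -, -, hr, hnew⟩ := h
  have := (hc i).le_of_new (by simp [PState.InLoop, hpc]) (by rw [hnew, hr])
  rwa [hr] at this

end AlgoAk

open AlgoAk in
/-- Lemma 10: in every execution of `A_k` in which both processes decide, if
`{r₁, r₂} = {k−1, k}` then neither process decides via the normal-termination
branch. -/
theorem no_normal_decision_when_k_km1 (k : ℕ) (hk : 1 ≤ k) (x : Fin 2 → Bool)
    (sched : ℕ → Fin 2) (n₁ n₂ : ℕ)
    (h1 : ((run k x sched n₁).p 0).pc = PC.done)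
    (h2 : ((run k x sched n₂).p 1).pc = PC.done)
    (hr : (((run k x sched n₁).p 0).r = k - 1 ∧ ((run k x sched n₂).p 1).r = k) ∨
          (((run k x sched n₁).p 0).r = k ∧ ((run k x sched n₂).p 1).r = k - 1)) :
    ∀ (n : ℕ) (i : Fin 2), ¬ decidedNormal k (x i) ((run k x sched n).p i) := by
  intro n i h
  set M := max n (max n₁ n₂)
  have e0 := run_p_of_done h1 (show n₁ ≤ M by omega)
  have e1 := run_p_of_done h2 (show n₂ ≤ M by omega)
  have ei := run_p_of_done h.1 (show n ≤ M by omega)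
  rw [← e0, ← e1] at hr
  rw [← ei] at h
  have hri : ((run k x sched M).p i).r = k := by
    obtain ⟨-, -, -, -, hr, -⟩ := h
    exact hr
  have hk_le := (le_writes_of_decidedNormal (run_valid k x sched M) h).trans
    (PState.writes_le_r _)
  fin_cases i <;> simp [other] at hri hk_le <;> omega
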